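/- Let B denote the space of bounded measurable real functions on [0,1], let A : B → B be linear with a measurable ω : [0,1]² → [0,∞) satisfying ∫₀¹ ω(u,s) du ≤ 1 for every s and |(Ah)(s)| ≤ ∫₀¹ |h(u)| ω(u,s) du for all h ∈ B and s ∈ [0,1], let α₀ : [0,1] → ℝ be bounded measurable with ᾱ₀ := sup_{s∈[0,1]} |α₀(s)|, and define γ(h,s) := α₀(s)·(Ah)(s) with iterates γ⁰(h,s) := h(s) and γ^ℓ(h,s) := γ(γ^{ℓ−1}(h,·), s). Let W = (w_{mk}) be an n×n real matrix with ᾱ₀ · ‖W‖_∞ < 1, let e_i ∈ ℝⁿ be the i-th standard basis vector, and let β ∈ B. Then the functions M_k(s) := Σ_{ℓ=0}^∞ (W^ℓ e_i)_k · γ^ℓ(β,s), k = 1,…,n, are well defined (the series converges uniformly in s), each M_k ∈ B, and M solves the simultaneous system: for every m ∈ {1,…,n} and every s ∈ [0,1], M_m(s) = α₀(s) · Σ_{k=1}^n w_{mk} (A M_k)(s) + (e_i)_m β(s). -/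

import Mathlib

open MeasureTheory Matrix Filter

/-- Membership in `B`, the space of bounded measurable real functions on `[0,1]`
(modelled as measurable functions `ℝ → ℝ` that are bounded on `[0,1]`). -/
def IsBddMeas (h : ℝ → ℝ) : Prop :=
  Measurable h ∧ ∃ M : ℝ, ∀ s ∈ Set.Icc (0 : ℝ) 1, |h s| ≤ M

/-- The supremum `sup_{s ∈ [0,1]} |f(s)|`. -/
noncomputable def supAbs01 (f : ℝ → ℝ) : ℝ :=
  sSup ((fun s => |f s|) '' Set.Icc (0 : ℝ) 1)

/-- The iterates `γ⁰(h,s) = h(s)`, `γ^ℓ(h,s) = α(s) · (A γ^{ℓ−1}(h,·))(s)`. -/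
noncomputable def gammaIter (α : ℝ → ℝ) (A : (ℝ → ℝ) → ℝ → ℝ) : ℕ → (ℝ → ℝ) → ℝ → ℝ
  | 0, h => h
  | ℓ + 1, h => fun s => α s * A (gammaIter α A ℓ h) s

/-- The `k`-th component of `M(s) = Σ_{ℓ=0}^∞ W^ℓ e_i γ^ℓ(β,s)`. -/
noncomputable def neumannM (α : ℝ → ℝ) (A : (ℝ → ℝ) → ℝ → ℝ) {n : ℕ}
    (W : Matrix (Fin n) (Fin n) ℝ) (i : Fin n) (β : ℝ → ℝ) (k : Fin n) (s : ℝ) : ℝ :=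
  ∑' ℓ : ℕ, ((W ^ ℓ) *ᵥ Pi.single i 1) k * gammaIter α A ℓ β s

theorem IsBddMeas.add {f g : ℝ → ℝ} (hf : IsBddMeas f) (hg : IsBddMeas g) :
    IsBddMeas (f + g) := by
  obtain ⟨hfm, a, ha⟩ := hf
  obtain ⟨hgm, b, hb⟩ := hg
  exact ⟨hfm.add hgm, a + b, fun s hs =>
    (abs_add_le _ _).trans (add_le_add (ha s hs) (hb s hs))⟩

theorem IsBddMeas.mul {f g : ℝ → ℝ} (hf : IsBddMeas f) (hg : IsBddMeas g) :
    IsBddMeas (fun s => f s * g s) := by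
  obtain ⟨hfm, a, ha⟩ := hf
  obtain ⟨hgm, b, hb⟩ := hg
  refine ⟨hfm.mul hgm, a * b, fun s hs => ?_⟩
  rw [abs_mul]
  exact mul_le_mul (ha s hs) (hb s hs) (abs_nonneg _) ((abs_nonneg _).trans (ha s hs))

theorem isBddMeas_const (c : ℝ) : IsBddMeas (fun _ => c) :=
  ⟨measurable_const, |c|, fun _ _ => le_rfl⟩

theorem IsBddMeas.smul {f : ℝ → ℝ} (c : ℝ) (hf : IsBddMeas f) : IsBddMeas (c • f) :=
  (isBddMeas_const c).mul hf

theorem isBddMeas_sum {ι : Type*} (t : Finset ι) {f : ι → ℝ → ℝ}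
    (hf : ∀ i, IsBddMeas (f i)) : IsBddMeas (∑ i ∈ t, f i) := by
  classical
  induction t using Finset.induction_on with
  | empty => exact isBddMeas_const 0
  | insert a t ha ih => rw [Finset.sum_insert ha]; exact (hf a).add ih

theorem map_sum_smul_of_isBddMeas {A : (ℝ → ℝ) → ℝ → ℝ}
    (hadd : ∀ f g, IsBddMeas f → IsBddMeas g → A (f + g) = A f + A g)
    (hsmul : ∀ (c : ℝ) (f : ℝ → ℝ), IsBddMeas f → A (c • f) = c • A f)
    {ι : Type*} (t : Finset ι) (c : ι → ℝ) {f : ι → ℝ → ℝ} (hf : ∀ i, IsBddMeas (f i)) :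
    A (∑ i ∈ t, c i • f i) = ∑ i ∈ t, c i • A (f i) := by
  classical
  induction t using Finset.induction_on with
  | empty => simpa using hsmul 0 0 (isBddMeas_const 0)
  | insert a t ha ih =>
    rw [Finset.sum_insert ha, Finset.sum_insert ha,
      hadd _ _ ((hf a).smul _) (isBddMeas_sum t fun i => (hf i).smul _), hsmul _ _ (hf a), ih]

theorem abs_le_supAbs01 {f : ℝ → ℝ} (hf : IsBddMeas f) {s : ℝ} (hs : s ∈ Set.Icc (0 : ℝ) 1) :
    |f s| ≤ supAbs01 f := by
  obtain ⟨-, M, hM⟩ := hf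
  refine le_csSup ⟨M, ?_⟩ ⟨s, hs, rfl⟩
  rintro _ ⟨u, hu, rfl⟩
  exact hM u hu

/-- An operator dominated by a sub-Markov kernel does not increase sup-norm bounds on `[0,1]`. -/
theorem abs_apply_le_of_dominated {A : (ℝ → ℝ) → ℝ → ℝ} {ω : ℝ → ℝ → ℝ}
    (hωmeas : Measurable (Function.uncurry ω)) (hωpos : ∀ u s, 0 ≤ ω u s)
    (hωint : ∀ s ∈ Set.Icc (0 : ℝ) 1,
      ∫⁻ u in Set.Icc (0 : ℝ) 1, ENNReal.ofReal (ω u s) ≤ 1)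
    (hdom : ∀ h, IsBddMeas h → ∀ s ∈ Set.Icc (0 : ℝ) 1,
      |A h s| ≤ ∫ u in Set.Icc (0 : ℝ) 1, |h u| * ω u s)
    {h : ℝ → ℝ} (hh : IsBddMeas h) {C : ℝ} (hC : ∀ u ∈ Set.Icc (0 : ℝ) 1, |h u| ≤ C)
    {s : ℝ} (hs : s ∈ Set.Icc (0 : ℝ) 1) : |A h s| ≤ C := by
  have hC0 : 0 ≤ C := (abs_nonneg _).trans (hC s hs)
  have hmeas : Measurable fun u => ω u s := hωmeas.comp (measurable_id.prodMk measurable_const)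
  have hint : Integrable (fun u => ω u s) (volume.restrict (Set.Icc (0 : ℝ) 1)) := by
    refine ⟨hmeas.aestronglyMeasurable, ?_⟩
    rw [hasFiniteIntegral_iff_ofReal (Eventually.of_forall fun u => hωpos u s)]
    exact (hωint s hs).trans_lt ENNReal.one_lt_top
  have hle : ∫ u in Set.Icc (0 : ℝ) 1, ω u s ≤ 1 := by
    rw [integral_eq_lintegral_of_nonneg_ae (Eventually.of_forall fun u => hωpos u s)
      hmeas.aestronglyMeasurable]
    exact ENNReal.toReal_le_of_le_ofReal zero_le_one (by simpa using hωint s hs)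
  calc |A h s| ≤ ∫ u in Set.Icc (0 : ℝ) 1, |h u| * ω u s := hdom h hh s hs
    _ ≤ ∫ u in Set.Icc (0 : ℝ) 1, C * ω u s := by
        refine integral_mono_of_nonneg
          (Eventually.of_forall fun u => mul_nonneg (abs_nonneg _) (hωpos u s))
          (hint.const_mul C) ?_
        filter_upwards [ae_restrict_mem measurableSet_Icc] with u hu
        exact mul_le_mul_of_nonneg_right (hC u hu) (hωpos u s)
    _ = C * ∫ u in Set.Icc (0 : ℝ) 1, ω u s := integral_const_mul _ _
    _ ≤ C := mul_le_of_le_one_right hC0 hle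

theorem isBddMeas_gammaIter {α : ℝ → ℝ} {A : (ℝ → ℝ) → ℝ → ℝ}
    (hAB : ∀ h, IsBddMeas h → IsBddMeas (A h)) (hα : IsBddMeas α) {β : ℝ → ℝ}
    (hβ : IsBddMeas β) (ℓ : ℕ) : IsBddMeas (gammaIter α A ℓ β) := by
  induction ℓ with
  | zero => exact hβ
  | succ ℓ ih => exact hα.mul (hAB _ ih)

theorem abs_gammaIter_le {α : ℝ → ℝ} {A : (ℝ → ℝ) → ℝ → ℝ}
    (hAB : ∀ h, IsBddMeas h → IsBddMeas (A h))
    (hA : ∀ h, IsBddMeas h → ∀ C, (∀ u ∈ Set.Icc (0 : ℝ) 1, |h u| ≤ C) →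
      ∀ s ∈ Set.Icc (0 : ℝ) 1, |A h s| ≤ C)
    (hα : IsBddMeas α) {β : ℝ → ℝ} (hβ : IsBddMeas β) {C : ℝ}
    (hC : ∀ u ∈ Set.Icc (0 : ℝ) 1, |β u| ≤ C) (ℓ : ℕ) :
    ∀ s ∈ Set.Icc (0 : ℝ) 1, |gammaIter α A ℓ β s| ≤ supAbs01 α ^ ℓ * C := by
  induction ℓ with
  | zero => simpa [gammaIter] using hC
  | succ ℓ ih =>
    intro s hs
    rw [gammaIter, abs_mul, pow_succ', mul_assoc]
    exact mul_le_mul (abs_le_supAbs01 hα hs) (hA _ (isBddMeas_gammaIter hAB hα hβ ℓ) _ ih s hs)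
      (abs_nonneg _) ((abs_nonneg _).trans (abs_le_supAbs01 hα hs))

theorem abs_pow_mulVec_le {n : ℕ} (W : Matrix (Fin n) (Fin n) ℝ) {v : Fin n → ℝ} {C : ℝ}
    (hv : ∀ j, |v j| ≤ C) (ℓ : ℕ) (k : Fin n) :
    |((W ^ ℓ) *ᵥ v) k| ≤ (⨆ k : Fin n, ∑ j, |W k j|) ^ ℓ * C := by
  induction ℓ generalizing k with
  | zero => simpa using hv k
  | succ ℓ ih =>
    rw [pow_succ', ← Matrix.mulVec_mulVec]
    calc |(W *ᵥ (W ^ ℓ *ᵥ v)) k| = |∑ j, W k j * (W ^ ℓ *ᵥ v) j| := rfl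
      _ ≤ ∑ j, |W k j * (W ^ ℓ *ᵥ v) j| := Finset.abs_sum_le_sum_abs _ _
      _ ≤ ∑ j, |W k j| * ((⨆ k : Fin n, ∑ j, |W k j|) ^ ℓ * C) := by
          refine Finset.sum_le_sum fun j _ => ?_
          rw [abs_mul]
          exact mul_le_mul_of_nonneg_left (ih j) (abs_nonneg _)
      _ = (∑ j, |W k j|) * ((⨆ k : Fin n, ∑ j, |W k j|) ^ ℓ * C) := by rw [Finset.sum_mul]
      _ ≤ (⨆ k : Fin n, ∑ j, |W k j|) * ((⨆ k : Fin n, ∑ j, |W k j|) ^ ℓ * C) :=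
          mul_le_mul_of_nonneg_right (le_ciSup (f := fun k => ∑ j, |W k j|)
            (Set.finite_range _).bddAbove k) ((abs_nonneg _).trans (ih k))
      _ = _ := by ring

/-- under the domination assumption on `A` and the contraction condition
`ᾱ₀ ‖W‖_∞ < 1`, the series defining `M_k(s) = Σ_ℓ (W^ℓ e_i)_k γ^ℓ(β,s)` converges
uniformly in `s ∈ [0,1]` (its partial sums converge uniformly to `M_k`), each `M_k`
belongs to `B`, and `M` solves the simultaneous system
`M_m(s) = α₀(s) Σ_k w_{mk} (A M_k)(s) + (e_i)_m β(s)` on `[0,1]`. -/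
theorem stmt11 (A : (ℝ → ℝ) → ℝ → ℝ)
    (hadd : ∀ f g, IsBddMeas f → IsBddMeas g → A (f + g) = A f + A g)
    (hsmul : ∀ (c : ℝ) (f : ℝ → ℝ), IsBddMeas f → A (c • f) = c • A f)
    (hAB : ∀ h, IsBddMeas h → IsBddMeas (A h))
    (ω : ℝ → ℝ → ℝ)
    (hωmeas : Measurable (Function.uncurry ω))
    (hωpos : ∀ u s, 0 ≤ ω u s)
    (hωint : ∀ s ∈ Set.Icc (0 : ℝ) 1,
      ∫⁻ u in Set.Icc (0 : ℝ) 1, ENNReal.ofReal (ω u s) ≤ 1)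
    (hdom : ∀ h, IsBddMeas h → ∀ s ∈ Set.Icc (0 : ℝ) 1,
      |A h s| ≤ ∫ u in Set.Icc (0 : ℝ) 1, |h u| * ω u s)
    (α₀ : ℝ → ℝ) (hα₀ : IsBddMeas α₀)
    {n : ℕ} (W : Matrix (Fin n) (Fin n) ℝ)
    (hcontr : supAbs01 α₀ * (⨆ k : Fin n, ∑ j, |W k j|) < 1)
    (β : ℝ → ℝ) (hβ : IsBddMeas β) (i : Fin n) :
    (∀ k : Fin n, TendstoUniformlyOn
      (fun (S : ℕ) (s : ℝ) =>
        ∑ ℓ ∈ Finset.range S, ((W ^ ℓ) *ᵥ Pi.single i 1) k * gammaIter α₀ A ℓ β s)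
      (neumannM α₀ A W i β k) atTop (Set.Icc (0 : ℝ) 1)) ∧
    (∀ k : Fin n, IsBddMeas (neumannM α₀ A W i β k)) ∧
    (∀ m : Fin n, ∀ s ∈ Set.Icc (0 : ℝ) 1,
      neumannM α₀ A W i β m s =
        α₀ s * ∑ k, W m k * A (neumannM α₀ A W i β k) s + (Pi.single i 1 : Fin n → ℝ) m * β s) := by
  have hA : ∀ h, IsBddMeas h → ∀ C, (∀ u ∈ Set.Icc (0 : ℝ) 1, |h u| ≤ C) →
      ∀ s ∈ Set.Icc (0 : ℝ) 1, |A h s| ≤ C := fun h hh C hC s hs =>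
    abs_apply_le_of_dominated hωmeas hωpos hωint hdom hh hC hs
  have h0 : (0 : ℝ) ∈ Set.Icc (0 : ℝ) 1 := ⟨le_rfl, zero_le_one⟩
  obtain ⟨C, hC⟩ := hβ.2
  have hγ := isBddMeas_gammaIter hAB hα₀ hβ
  set w : ℝ := ⨆ k : Fin n, ∑ j, |W k j|
  set c : ℕ → Fin n → ℝ := fun ℓ => (W ^ ℓ) *ᵥ Pi.single i 1 with hc
  have hw0 : 0 ≤ w := Real.iSup_nonneg fun k => Finset.sum_nonneg fun j _ => abs_nonneg _
  have ha0 : 0 ≤ supAbs01 α₀ := (abs_nonneg _).trans (abs_le_supAbs01 hα₀ h0)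
  have hcbound : ∀ ℓ k, |c ℓ k| ≤ w ^ ℓ := fun ℓ k => by
    have hsingle : ∀ j, |(Pi.single i 1 : Fin n → ℝ) j| ≤ 1 := fun j => by
      by_cases hj : j = i <;> simp [hj]
    simpa only [mul_one] using abs_pow_mulVec_le W hsingle ℓ k
  have hbound : ∀ k ℓ, ∀ s ∈ Set.Icc (0 : ℝ) 1,
      ‖c ℓ k * gammaIter α₀ A ℓ β s‖ ≤ (supAbs01 α₀ * w) ^ ℓ * C := fun k ℓ s hs => by
    rw [Real.norm_eq_abs, abs_mul, mul_pow, mul_comm (supAbs01 α₀ ^ ℓ), mul_assoc]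
    exact mul_le_mul (hcbound ℓ k) (abs_gammaIter_le hAB hA hα₀ hβ hC ℓ s hs) (abs_nonneg _)
      (pow_nonneg hw0 ℓ)
  have hsummable : Summable fun ℓ : ℕ => (supAbs01 α₀ * w) ^ ℓ * C :=
    (summable_geometric_of_lt_one (mul_nonneg ha0 hw0) hcontr).mul_right C
  have hunif : ∀ k : Fin n, TendstoUniformlyOn
      (fun (S : ℕ) (s : ℝ) => ∑ ℓ ∈ Finset.range S, c ℓ k * gammaIter α₀ A ℓ β s)
      (neumannM α₀ A W i β k) atTop (Set.Icc (0 : ℝ) 1) := fun k =>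
    tendstoUniformlyOn_tsum_nat hsummable fun ℓ s hs => hbound k ℓ s hs
  have hM : ∀ k : Fin n, IsBddMeas (neumannM α₀ A W i β k) := fun k =>
    ⟨Measurable.tsum fun ℓ => (hγ ℓ).1.const_mul _, _, fun s hs =>
      tsum_of_norm_bounded hsummable.hasSum fun ℓ => hbound k ℓ s hs⟩
  refine ⟨hunif, hM, fun m s hs => ?_⟩
  have hpart : ∀ k S, IsBddMeas (∑ ℓ ∈ Finset.range S, c ℓ k • gammaIter α₀ A ℓ β) :=
    fun k S => isBddMeas_sum _ fun ℓ => (hγ ℓ).smul _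
  have hAlim : ∀ k, Tendsto
      (fun S : ℕ => ∑ ℓ ∈ Finset.range S, c ℓ k * A (gammaIter α₀ A ℓ β) s) atTop
      (nhds (A (neumannM α₀ A W i β k) s)) := fun k => by
    rw [Metric.tendsto_atTop]
    intro ε hε
    obtain ⟨N, hN⟩ := eventually_atTop.1 (Metric.tendstoUniformlyOn_iff.1 (hunif k) (ε / 2)
      (half_pos hε))
    refine ⟨N, fun S hS => ?_⟩
    have hdiff := hA _ ((hM k).add ((hpart k S).smul (-1))) (ε / 2)
      (fun u hu => by simpa [Real.dist_eq, sub_eq_add_neg] using (hN S hS u hu).le) s hs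
    rw [hadd _ _ (hM k) ((hpart k S).smul (-1)), hsmul _ _ (hpart k S),
      map_sum_smul_of_isBddMeas hadd hsmul _ _ hγ] at hdiff
    rw [dist_comm, Real.dist_eq]
    refine lt_of_le_of_lt ?_ (half_lt_self hε)
    simpa [sub_eq_add_neg] using hdiff
  have hright : Tendsto (fun S : ℕ => α₀ s * ∑ k, W m k *
        ∑ ℓ ∈ Finset.range S, c ℓ k * A (gammaIter α₀ A ℓ β) s +
        (Pi.single i 1 : Fin n → ℝ) m * β s) atTop
      (nhds (α₀ s * ∑ k, W m k * A (neumannM α₀ A W i β k) s +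
        (Pi.single i 1 : Fin n → ℝ) m * β s)) :=
    ((tendsto_finsetSum _ fun k _ => (hAlim k).const_mul (W m k)).const_mul (α₀ s)).add_const _
  refine tendsto_nhds_unique
    (((hunif m).tendsto_at hs).comp (tendsto_add_atTop_nat 1)) (hright.congr fun S => ?_)
  have hcsucc : ∀ ℓ, c (ℓ + 1) m = ∑ k, W m k * c ℓ k := fun ℓ => by
    simp only [hc, pow_succ', ← Matrix.mulVec_mulVec]
    rfl
  simp only [Function.comp_apply, Finset.sum_range_succ', hcsucc, gammaIter]
  congr 1
  · simp only [Finset.mul_sum, Finset.sum_mul]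
    rw [Finset.sum_comm]
    exact Finset.sum_congr rfl fun ℓ _ => Finset.sum_congr rfl fun k _ => by ring
  · simp only [hc, pow_zero, Matrix.one_mulVec]
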